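/- Consider a single access by a minimally self-adjusting BST algorithm: element s is accessed in tree T with search path P, producing tree T'. For every subtree-disjoint set X ⊆ P and every positive weight function w: |X| ≤ 2 + 8·log(W/w(T(s))) + Φ_T(X) − Φ_{T'}(X), where T(s) is the subtree of T rooted at s before the access. -/

import Mathlib

namespace Paper

inductive BTree where
  | nil : BTree
  | node : BTree → ℕ → BTree → BTree
deriving DecidableEq

namespace BTree

def keys : BTree → Finset ℕ
  | nil => ∅
  | node l x r => insert x (keys l ∪ keys r)

def root? : BTree → Option ℕ
  | nil => none
  | node _ x _ => some x

def isBST : BTree → Prop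
  | nil => True
  | node l x r => (∀ y ∈ keys l, y < x) ∧ (∀ y ∈ keys r, x < y) ∧ isBST l ∧ isBST r

def subtree? (s : ℕ) : BTree → Option BTree
  | nil => none
  | node l x r => if s = x then some (node l x r) else if s < x then subtree? s l else subtree? s r

/-- The set of keys of the subtree rooted at `s` (∅ if `s` is not in the tree). -/
def subtreeKeys (T : BTree) (s : ℕ) : Finset ℕ := ((subtree? s T).map keys).getD ∅

/-- The search path to `s`, listed from the root downwards. -/
def pathList (s : ℕ) : BTree → List ℕ
  | nil => []
  | node l x r => if s = x then [x] else if s < x then x :: pathList s l else x :: pathList s r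

def pathSet (T : BTree) (s : ℕ) : Finset ℕ := (pathList s T).toFinset

def nodeDepth (s : ℕ) : BTree → ℕ
  | nil => 0
  | node l x r => if s = x then 0 else if s < x then nodeDepth s l + 1 else nodeDepth s r + 1

/-- Number of right-going edges on the path from the root to `s`. -/
def rightDepth (s : ℕ) : BTree → ℕ
  | nil => 0
  | node l x r => if s = x then 0 else if s < x then rightDepth s l else rightDepth s r + 1

/-- Number of left-going edges on the path from the root to `s`. -/
def leftDepth (s : ℕ) : BTree → ℕ
  | nil => 0
  | node l x r => if s = x then 0 else if s < x then leftDepth s l + 1 else leftDepth s r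

def leafCount : BTree → ℕ
  | nil => 0
  | node nil _ nil => 1
  | node l _ r => leafCount l + leafCount r

/-- The wing partition of a BST, each wing listed from its topmost node downwards. -/
def wings : BTree → List (List ℕ)
  | nil => []
  | node l x r =>
    match wings l with
    | [] => [x] :: wings r
    | wl :: rest => (x :: wl) :: (rest ++ wings r)

end BTree

open BTree

/-- The left-leaning path on `[n]`: `n` at the root, `1` at the deepest node. -/
def leftPathTree : ℕ → BTree
  | 0 => BTree.nil
  | n + 1 => BTree.node (leftPathTree n) (n + 1) BTree.nil

/-- Number of side alternations (w.r.t. `s`) between adjacent elements of a list. -/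
def sideAlt (s : ℕ) : List ℕ → ℕ
  | x :: y :: rest => (if (x < s ∧ s < y) ∨ (y < s ∧ s < x) then 1 else 0) + sideAlt s (y :: rest)
  | _ => 0

/-- The set of elements involved in side alternations (w.r.t. `s`) in a list. -/
def zigzagSet (s : ℕ) : List ℕ → Finset ℕ
  | x :: y :: rest =>
    (if (x < s ∧ s < y) ∨ (y < s ∧ s < x) then ({x, y} : Finset ℕ) else ∅) ∪ zigzagSet s (y :: rest)
  | _ => ∅

noncomputable def wsum (w : ℕ → ℝ) (X : Finset ℕ) : ℝ := ∑ b ∈ X, w b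

/-- Partial sum-of-logs potential of the set `X` in tree `T` (binary logarithm). -/
noncomputable def phiOn (w : ℕ → ℝ) (T : BTree) (X : Finset ℕ) : ℝ :=
  ∑ a ∈ X, Real.logb 2 (wsum w (subtreeKeys T a))

noncomputable def phiAll (w : ℕ → ℝ) (T : BTree) : ℝ := phiOn w T (keys T)

/-- A single access of a minimally self-adjusting BST algorithm: the accessed element `s`
becomes the root, the keys are unchanged, and every node off the search path keeps its
subtree; hence the search path is replaced by an after-tree rooted at `s` and the pendent
subtrees are reattached in the unique order-preserving way. -/
structure IsAccess (T : BTree) (s : ℕ) (T' : BTree) : Prop where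
  hT : isBST T
  hT' : isBST T'
  hs : s ∈ keys T
  hkeys : keys T' = keys T
  hroot : root? T' = some s
  hpendent : ∀ a ∈ keys T, a ∉ pathSet T s → subtree? a T' = subtree? a T

/-- The algorithm (viewed as the set of accesses it may perform) satisfies the access lemma
via the sum-of-logs potential. -/
def SatisfiesAL (Alg : BTree → ℕ → BTree → Prop) : Prop :=
  ∃ C : ℝ, 0 ≤ C ∧ ∀ T s T', Alg T s T' → ∀ w : ℕ → ℝ, (∀ i ∈ keys T, 0 < w i) →
    ((pathSet T s).card : ℝ) ≤
      phiAll w T - phiAll w T' + C * (1 + Real.logb 2 (wsum w (keys T) / w s))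

/-- `X` is subtree-disjoint (w.r.t. the tree after the access). -/
def SubtreeDisjoint (T' : BTree) (X : Finset ℕ) : Prop :=
  ∀ a ∈ X, ∀ b ∈ X, a ≠ b → subtreeKeys T' a ∩ subtreeKeys T' b = ∅

/-- `X` is monotone: all elements on one side of `s`, with equal right-depth
(resp. left-depth) in the after-tree.  (For nodes of the search path, depth in the
after-tree coincides with depth in `T'`.) -/
def IsMonotone (s : ℕ) (T' : BTree) (X : Finset ℕ) : Prop :=
  ((∀ x ∈ X, s < x) ∧ ∃ d, ∀ x ∈ X, rightDepth x T' = d) ∨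
  ((∀ x ∈ X, x < s) ∧ ∃ d, ∀ x ∈ X, leftDepth x T' = d)

/-- The after-tree minus its root can be partitioned into (at most) `k` monotone sets. -/
def MonotoneDecomp (T : BTree) (s : ℕ) (T' : BTree) (k : ℕ) : Prop :=
  ∃ M : Fin k → Finset ℕ,
    (∀ i, IsMonotone s T' (M i)) ∧
    (∀ i j, i ≠ j → Disjoint (M i) (M j)) ∧
    Finset.univ.biUnion M = pathSet T s \ {s}

/-- The leaves of the after-tree: path nodes having no path node as proper descendant in `T'`. -/
def afterLeaves (T : BTree) (s : ℕ) (T' : BTree) : Finset ℕ :=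
  (pathSet T s).filter (fun x => subtreeKeys T' x ∩ pathSet T s = {x})

/-- Rotate-to-root: `s` becomes the root and ancestor relations are otherwise preserved,
equivalently `T'(a) = T(a) ∩ (-∞,s)` for path nodes `a < s` and symmetrically for `a > s`. -/
def IsRotateToRoot (T : BTree) (s : ℕ) (T' : BTree) : Prop :=
  subtreeKeys T' s = keys T ∧
  ∀ a ∈ pathSet T s,
    (a < s → subtreeKeys T' a = (subtreeKeys T a).filter (fun b => b < s)) ∧
    (s < a → subtreeKeys T' a = (subtreeKeys T a).filter (fun b => s < b))

def pendTree : Option ℕ → BTree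
  | none => BTree.nil
  | some u => BTree.node BTree.nil u BTree.nil

def buildLeft (l : List (ℕ × Option ℕ)) : BTree :=
  l.foldl (fun t vc => BTree.node (pendTree vc.2) vc.1 t) BTree.nil

def buildRight (l : List (ℕ × Option ℕ)) : BTree :=
  l.foldl (fun t vc => BTree.node t vc.1 (pendTree vc.2)) BTree.nil

/-- Global view of splay: process the reversed search path `v₁, v₂, …` in pairs; if a pair
lies on the same side of `s`, the more ancestral element is removed from its path and
becomes a (pendant) child of the other.  Returns the two spines (elements `< s` and `> s`),
deepest first, each spine node with its optional pendant child. -/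
def splaySpines (s : ℕ) : List ℕ → List (ℕ × Option ℕ) × List (ℕ × Option ℕ)
  | [] => ([], [])
  | [v] => if v < s then ([(v, none)], []) else ([], [(v, none)])
  | v :: u :: rest =>
    let p := splaySpines s rest
    if v < s then
      if u < s then ((v, some u) :: p.1, p.2)
      else ((v, none) :: p.1, (u, none) :: p.2)
    else
      if u < s then ((u, none) :: p.1, (v, none) :: p.2)
      else (p.1, (v, some u) :: p.2)

/-- The after-tree of a splay access, built from the reversed search path without `s`. -/
def splayAfterTree (s : ℕ) (l : List ℕ) : BTree :=
  BTree.node (buildLeft (splaySpines s l).1) s (buildRight (splaySpines s l).2)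

/-- A splay access: a valid access whose after-tree (the restriction of `T'` to the search
path) is the splay after-tree. -/
def IsSplayAccess (T : BTree) (s : ℕ) (T' : BTree) : Prop :=
  IsAccess T s T' ∧
  ∀ x ∈ pathSet T s,
    subtreeKeys T' x ∩ pathSet T s = subtreeKeys (splayAfterTree s (pathList s T).reverse.tail) x

/-- A path-balance access: a valid access whose after-tree is a balanced BST of depth
`⌈log₂ (1 + |P|)⌉` rooted at `s`. -/
def IsPathBalanceAccess (T : BTree) (s : ℕ) (T' : BTree) : Prop :=
  IsAccess T s T' ∧
  ∀ x ∈ pathSet T s, nodeDepth x T' ≤ Nat.clog 2 (1 + (pathSet T s).card)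

def isParent (Q : BTree) (x y : ℕ) : Prop := pathList y Q = pathList x Q ++ [y]

/-- One step of a decomposition: a (descending) path `Pi` of `Q` is rearranged into a tree,
all other nodes keeping their subtrees. -/
def StepRel (Q Q' : BTree) (Pi : Finset ℕ) : Prop :=
  isBST Q' ∧ keys Q' = keys Q ∧
  (∃ l : List ℕ, l ≠ [] ∧ List.Chain' (isParent Q) l ∧ l.toFinset = Pi) ∧
  (∀ a ∈ keys Q, a ∉ Pi → subtree? a Q' = subtree? a Q)

/-- The transformation of the before-path `P0` (as a tree) into the after-tree `A` admits a
local decomposition with window size `wdw`. -/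
def HasLocalDecomp (s : ℕ) (P0 A : BTree) (wdw : ℕ) : Prop :=
  ∃ (k : ℕ) (Q : ℕ → BTree) (Ps : ℕ → Finset ℕ),
    1 ≤ k ∧ Q 0 = P0 ∧ Q k = A ∧
    (∀ i < k, StepRel (Q i) (Q (i + 1)) (Ps i)) ∧
    s ∈ Ps 0 ∧
    (∀ i, i + 1 < k → (Ps (i + 1) \ Ps i).Nonempty) ∧
    (∀ i, i + 1 < k → (Ps (i + 1) ∩ Ps i).Nonempty) ∧
    (∀ i j, i + 1 < j → j < k → Disjoint (Ps i \ Ps (i + 1)) (Ps j)) ∧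
    (∀ i < k, (Ps i).card ≤ wdw)

/-- The search path to `s` in `T`, as a tree (the before-path of the transformation). -/
def pathTree (s : ℕ) : BTree → BTree
  | BTree.nil => BTree.nil
  | BTree.node l x r =>
    if s = x then BTree.node BTree.nil x BTree.nil
    else if s < x then BTree.node (pathTree s l) x BTree.nil
    else BTree.node BTree.nil x (pathTree s r)

/-- `A` is the after-tree of the access `(T, s, T')`: the restriction of `T'` to the search path. -/
def IsAfterTree (T : BTree) (s : ℕ) (T' A : BTree) : Prop :=
  isBST A ∧ keys A = pathSet T s ∧
  ∀ x ∈ pathSet T s, subtreeKeys A x = subtreeKeys T' x ∩ pathSet T s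

/-- The algorithm is local with window size `wdw`. -/
def IsLocal (Alg : BTree → ℕ → BTree → Prop) (wdw : ℕ) : Prop :=
  ∀ T s T', Alg T s T' → ∀ A, IsAfterTree T s T' A → HasLocalDecomp s (pathTree s T) A wdw

open scoped Classical in
noncomputable def stair (n : ℕ) (h : ℕ → ℕ) (s : ℕ) : Finset ℕ :=
  (Finset.Icc 1 n).filter
    (fun b => ∀ b' ∈ Finset.Icc 1 n, ((s < b' ∧ b' < b) ∨ (b < b' ∧ b' < s)) → h b' < h b)

open scoped Classical in
noncomputable def nbhd (n : ℕ) (h : ℕ → ℕ) (a : ℕ) : Finset ℕ :=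
  (Finset.Icc 1 n).filter
    (fun b => ∀ b' ∈ Finset.Icc 1 n, b' ≠ a → min a b ≤ b' → b' ≤ max a b → h b' < h a)

/-- Geometric sum-of-logs partial potential. -/
noncomputable def phiGeo (n : ℕ) (h : ℕ → ℕ) (w : ℕ → ℝ) (X : Finset ℕ) : ℝ :=
  ∑ a ∈ X, Real.logb 2 (wsum w (nbhd n h a))

/-- `l` is (the reversal of) a valid search path to `s`, without `s`, deepest element first. -/
def ValidRevPath (s : ℕ) (l : List ℕ) : Prop :=
  l.Nodup ∧ s ∉ l ∧
  l.Pairwise (fun a b => (a < s → b < s → b < a) ∧ (s < a → s < b → a < b))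

end Paper

open Paper Paper.BTree

namespace Paper

namespace BTree

lemma subtreeKeys_nil (a : ℕ) : subtreeKeys nil a = ∅ := rfl

lemma subtreeKeys_node (l r : BTree) (x a : ℕ) :
    subtreeKeys (node l x r) a =
      if a = x then keys (node l x r)
      else if a < x then subtreeKeys l a else subtreeKeys r a := by
  unfold subtreeKeys
  rw [subtree?]
  split_ifs <;> rfl

lemma mem_keys_node {l r : BTree} {x y : ℕ} :
    y ∈ keys (node l x r) ↔ y = x ∨ y ∈ keys l ∨ y ∈ keys r := by
  simp [keys]

lemma subtreeKeys_subset_keys (T : BTree) (a : ℕ) : subtreeKeys T a ⊆ keys T := by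
  induction T with
  | nil => simp [subtreeKeys_nil]
  | node l x r ihl ihr =>
    intro y hy
    rw [subtreeKeys_node] at hy
    split_ifs at hy with h₁ h₂
    · exact hy
    · exact mem_keys_node.2 (.inr (.inl (ihl hy)))
    · exact mem_keys_node.2 (.inr (.inr (ihr hy)))

lemma mem_subtreeKeys_self {T : BTree} (hT : isBST T) {a : ℕ} (ha : a ∈ keys T) :
    a ∈ subtreeKeys T a := by
  induction T with
  | nil => simp [keys] at ha
  | node l x r ihl ihr =>
    obtain ⟨hl, hr, hTl, hTr⟩ := hT
    rw [subtreeKeys_node]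
    split_ifs with h₁ h₂
    · exact ha
    · refine ihl hTl ?_
      rcases mem_keys_node.1 ha with h | h | h
      · exact absurd h h₁
      · exact h
      · exact absurd (hr a h) (by omega)
    · refine ihr hTr ?_
      rcases mem_keys_node.1 ha with h | h | h
      · exact absurd h h₁
      · exact absurd (hl a h) h₂
      · exact h

lemma subtreeKeys_subset_of_mem {T : BTree} (hT : isBST T) {a b : ℕ}
    (hab : a ∈ subtreeKeys T b) : subtreeKeys T a ⊆ subtreeKeys T b := by
  induction T with
  | nil => simp [subtreeKeys_nil]
  | node l x r ihl ihr =>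
    obtain ⟨hl, hr, hTl, hTr⟩ := hT
    by_cases hb : b = x
    · rw [subtreeKeys_node _ _ _ b, if_pos hb]
      exact subtreeKeys_subset_keys _ _
    rw [subtreeKeys_node, if_neg hb] at hab
    rw [subtreeKeys_node _ _ _ b, if_neg hb]
    split_ifs at hab ⊢ with h₂
    · have hax := hl a (subtreeKeys_subset_keys _ _ hab)
      rw [subtreeKeys_node, if_neg hax.ne, if_pos hax]
      exact ihl hTl hab
    · have hax := hr a (subtreeKeys_subset_keys _ _ hab)
      rw [subtreeKeys_node, if_neg hax.ne', if_neg hax.not_gt]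
      exact ihr hTr hab

lemma mem_subtreeKeys_of_between {T : BTree} (hT : isBST T) {a x y z : ℕ}
    (hx : x ∈ subtreeKeys T a) (hz : z ∈ subtreeKeys T a) (hy : y ∈ keys T)
    (hxy : x ≤ y) (hyz : y ≤ z) : y ∈ subtreeKeys T a := by
  induction T with
  | nil => simp [keys] at hy
  | node l k r ihl ihr =>
    obtain ⟨hl, hr, hTl, hTr⟩ := hT
    rw [subtreeKeys_node] at hx hz ⊢
    split_ifs at hx hz ⊢ with h₁ h₂
    · exact hy
    · refine ihl hTl hx hz ?_
      have hzk := hl z (subtreeKeys_subset_keys _ _ hz)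
      rcases mem_keys_node.1 hy with h | h | h
      · omega
      · exact h
      · exact absurd (hr y h) (by omega)
    · refine ihr hTr hx hz ?_
      have hxk := hr x (subtreeKeys_subset_keys _ _ hx)
      rcases mem_keys_node.1 hy with h | h | h
      · omega
      · exact absurd (hl y h) (by omega)
      · exact h

lemma mem_keys_and_mem_subtreeKeys_of_mem_pathSet {T : BTree} (hT : isBST T) {s a : ℕ}
    (hs : s ∈ keys T) (ha : a ∈ pathSet T s) : a ∈ keys T ∧ s ∈ subtreeKeys T a := by
  rw [pathSet, List.mem_toFinset] at ha
  induction T with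
  | nil => simp [keys] at hs
  | node l x r ihl ihr =>
    obtain ⟨hl, hr, hTl, hTr⟩ := hT
    by_cases hax : a = x
    · rw [subtreeKeys_node, if_pos hax]
      exact ⟨mem_keys_node.2 (.inl hax), hs⟩
    rw [pathList] at ha
    split_ifs at ha with h₁ h₂
    · exact absurd (List.mem_singleton.1 ha) hax
    · have hsl : s ∈ keys l := by
        rcases mem_keys_node.1 hs with h | h | h
        · exact absurd h h₁
        · exact h
        · exact absurd (hr s h) (by omega)
      obtain ⟨hal, hsa⟩ := ihl hTl hsl ((List.mem_cons.1 ha).resolve_left hax)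
      rw [subtreeKeys_node, if_neg hax, if_pos (hl a hal)]
      exact ⟨mem_keys_node.2 (.inr (.inl hal)), hsa⟩
    · have hsr : s ∈ keys r := by
        rcases mem_keys_node.1 hs with h | h | h
        · exact absurd h h₁
        · exact absurd (hl s h) h₂
        · exact h
      obtain ⟨har, hsa⟩ := ihr hTr hsr ((List.mem_cons.1 ha).resolve_left hax)
      rw [subtreeKeys_node, if_neg hax, if_neg (hr a har).not_gt]
      exact ⟨mem_keys_node.2 (.inr (.inr har)), hsa⟩

lemma subtreeKeys_of_root? {T : BTree} {s : ℕ} (h : root? T = some s) :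
    subtreeKeys T s = keys T := by
  cases T with
  | nil => simp [root?] at h
  | node l x r =>
    obtain rfl : x = s := by simpa [root?] using h
    rw [subtreeKeys_node, if_pos rfl]

end BTree

lemma wsum_le_wsum {w : ℕ → ℝ} {K Y Z : Finset ℕ} (hw : ∀ i ∈ K, 0 < w i) (hYZ : Y ⊆ Z)
    (hZ : Z ⊆ K) : wsum w Y ≤ wsum w Z :=
  Finset.sum_le_sum_of_subset_of_nonneg hYZ fun i hi _ => (hw i (hZ hi)).le

lemma one_add_logb_two_le {x : ℝ} (hx : 0 < x) (hx1 : x ≤ 1) : 1 + Real.logb 2 x ≤ x := by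
  have h2 : 0 < Real.log 2 := Real.log_pos one_lt_two
  have h2' : Real.log 2 ≤ 1 := by linarith [Real.log_le_sub_one_of_pos two_pos]
  have hlog := Real.log_le_sub_one_of_pos hx
  have : Real.logb 2 x ≤ x - 1 := by
    rw [Real.logb, div_le_iff₀ h2]
    nlinarith
  linarith

lemma one_sub_inv_le_logb_two {x : ℝ} (hx : 1 ≤ x) : 1 - x⁻¹ ≤ Real.logb 2 x := by
  have h2 : 0 < Real.log 2 := Real.log_pos one_lt_two
  have h2' : Real.log 2 ≤ 1 := by linarith [Real.log_le_sub_one_of_pos two_pos]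
  have hlog := Real.one_sub_inv_le_log_of_pos (zero_lt_one.trans_le hx)
  rw [Real.logb, le_div_iff₀ h2]
  nlinarith [inv_le_one_of_one_le₀ hx]

lemma log_ratio_step {t t' S B : ℝ} (ht : 0 < t) (htB : t ≤ B) (ht' : 0 < t') (ht'B : t' ≤ B)
    (hSt : S ≤ t) :
    1 + Real.logb 2 t' + Real.logb 2 t + S / t ≤ 2 * Real.logb 2 B + (t' + S) / B := by
  have hB : 0 < B := ht.trans_le htB
  have h₁ := one_add_logb_two_le (div_pos ht' hB) ((div_le_one hB).2 ht'B)
  have h₂ := one_sub_inv_le_logb_two ((one_le_div ht).2 htB)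
  rw [Real.logb_div ht'.ne' hB.ne'] at h₁
  rw [Real.logb_div hB.ne' ht.ne', inv_div] at h₂
  have h₃ : S / t - S / B ≤ 1 - t / B := by
    have e₁ : S / t - S / B = S * (t⁻¹ - B⁻¹) := by ring
    have e₂ : 1 - t / B = t * (t⁻¹ - B⁻¹) := by field_simp
    rw [e₁, e₂]
    exact mul_le_mul_of_nonneg_right hSt (sub_nonneg.2 (inv_anti₀ ht htB))
  rw [add_div]
  linarith

/-- Potential bound for a family of sets `U' a` that are pairwise disjoint and dominated by an
increasing chain of sets `U a`, where the order is given by `f`. -/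
lemma sum_one_add_logb_sub_logb_le {K : Finset ℕ} {w : ℕ → ℝ} (hw : ∀ i ∈ K, 0 < w i)
    (U U' : ℕ → Finset ℕ) (f : ℕ → ℤ) {t₀ : ℝ} (ht₀ : 0 < t₀) (A : Finset ℕ)
    (hU' : ∀ a ∈ A, (U' a).Nonempty)
    (ht : ∀ a ∈ A, t₀ ≤ wsum w (U a))
    (hdisj : ∀ a ∈ A, ∀ b ∈ A, a ≠ b → Disjoint (U' a) (U' b))
    (hmono : ∀ a ∈ A, ∀ b ∈ A, a ≠ b → f a ≤ f b → U a ⊆ U b ∧ U' a ⊆ U b)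
    (V : Finset ℕ) (hVK : V ⊆ K) (hV : ∀ a ∈ A, U a ⊆ V ∧ U' a ⊆ V) (hV₀ : t₀ ≤ wsum w V) :
    ∑ a ∈ A, (1 + Real.logb 2 (wsum w (U' a)) - Real.logb 2 (wsum w (U a))) ≤
      2 * (Real.logb 2 (wsum w V) - Real.logb 2 t₀) + (∑ a ∈ A, wsum w (U' a)) / wsum w V := by
  induction A using Finset.induction_on_max_value f generalizing V with
  | empty =>
    have := Real.logb_le_logb_of_le one_lt_two ht₀ hV₀
    simp only [Finset.sum_empty, zero_div]
    linarith
  | insert c A hc hmax ih =>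
    have hcm := Finset.mem_insert_self c A
    have hm : ∀ {a}, a ∈ A → a ∈ insert c A := Finset.mem_insert_of_mem
    have hUc := hV c hcm
    have hsub : ∀ a ∈ A, U a ⊆ U c ∧ U' a ⊆ U c := fun a ha =>
      hmono a (hm ha) c hcm (fun h => hc (h ▸ ha)) (hmax a ha)
    have hIH := ih (fun a ha => hU' a (hm ha)) (fun a ha => ht a (hm ha))
      (fun a ha b hb => hdisj a (hm ha) b (hm hb)) (fun a ha b hb => hmono a (hm ha) b (hm hb))
      (U c) (hUc.1.trans hVK) hsub (ht c hcm)
    have hS : ∑ a ∈ A, wsum w (U' a) ≤ wsum w (U c) := by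
      have : ∑ a ∈ A, wsum w (U' a) = wsum w (A.biUnion U') :=
        (Finset.sum_biUnion fun a ha b hb => hdisj a (hm ha) b (hm hb)).symm
      rw [this]
      exact wsum_le_wsum hw (Finset.biUnion_subset.2 fun a ha => (hsub a ha).2)
        (hUc.1.trans hVK)
    have hpos : 0 < wsum w (U' c) :=
      Finset.sum_pos (fun i hi => hw i (hVK (hUc.2 hi))) (hU' c hcm)
    have hstep := log_ratio_step (ht₀.trans_le (ht c hcm)) (wsum_le_wsum hw hUc.1 hVK) hpos
      (wsum_le_wsum hw hUc.2 hVK) hS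
    rw [Finset.sum_insert hc, Finset.sum_insert hc]
    linarith

/-- The same bound in terms of the total weight of `V` only. -/
lemma sum_one_add_logb_sub_logb_le_add_one {K : Finset ℕ} {w : ℕ → ℝ} (hw : ∀ i ∈ K, 0 < w i)
    (U U' : ℕ → Finset ℕ) (f : ℕ → ℤ) {t₀ : ℝ} (ht₀ : 0 < t₀) (A : Finset ℕ)
    (hU' : ∀ a ∈ A, (U' a).Nonempty)
    (ht : ∀ a ∈ A, t₀ ≤ wsum w (U a))
    (hdisj : ∀ a ∈ A, ∀ b ∈ A, a ≠ b → Disjoint (U' a) (U' b))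
    (hmono : ∀ a ∈ A, ∀ b ∈ A, a ≠ b → f a ≤ f b → U a ⊆ U b ∧ U' a ⊆ U b)
    (hK : ∀ a ∈ A, U a ⊆ K ∧ U' a ⊆ K) (hK₀ : t₀ ≤ wsum w K) :
    ∑ a ∈ A, (1 + Real.logb 2 (wsum w (U' a)) - Real.logb 2 (wsum w (U a))) ≤
      2 * (Real.logb 2 (wsum w K) - Real.logb 2 t₀) + 1 := by
  have h := sum_one_add_logb_sub_logb_le hw U U' f ht₀ A hU' ht hdisj hmono K subset_rfl hK hK₀
  have hS : (∑ a ∈ A, wsum w (U' a)) / wsum w K ≤ 1 := by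
    rw [div_le_one (ht₀.trans_le hK₀)]
    have : ∑ a ∈ A, wsum w (U' a) = wsum w (A.biUnion U') := (Finset.sum_biUnion hdisj).symm
    rw [this]
    exact wsum_le_wsum hw (Finset.biUnion_subset.2 fun a ha => (hK a ha).2) subset_rfl
  linarith

end Paper

/-- **Lemma (subtree-disjoint sets).** For any access and any subtree-disjoint subset `X`
of the search path: `|X| ≤ 2 + 8·log(W / w(T(s))) + Φ_T(X) − Φ_{T'}(X)`. -/
theorem subtree_disjoint_lemma (T : BTree) (s : ℕ) (T' : BTree) (hacc : IsAccess T s T')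
    (X : Finset ℕ) (hX : X ⊆ pathSet T s) (hdisj : SubtreeDisjoint T' X)
    (w : ℕ → ℝ) (hw : ∀ i ∈ keys T, 0 < w i) :
    (X.card : ℝ) ≤
      2 + 8 * Real.logb 2 (wsum w (keys T) / wsum w (subtreeKeys T s)) +
        (phiOn w T X - phiOn w T' X) := by
  obtain ⟨hT, hT', hs, hkeys, hroot, -⟩ := hacc
  have hpath : ∀ a ∈ X, a ∈ keys T ∧ s ∈ subtreeKeys T a := fun a ha =>
    mem_keys_and_mem_subtreeKeys_of_mem_pathSet hT hs (hX ha)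
  have hself' : ∀ a ∈ X, a ∈ subtreeKeys T' a := fun a ha =>
    mem_subtreeKeys_self hT' (hkeys ▸ (hpath a ha).1)
  have hroot' : subtreeKeys T' s = keys T := (subtreeKeys_of_root? hroot).trans hkeys
  have ht₀ : 0 < wsum w (subtreeKeys T s) :=
    Finset.sum_pos (fun i hi => hw i (subtreeKeys_subset_keys _ _ hi))
      ⟨s, mem_subtreeKeys_self hT hs⟩
  have hW₀ : wsum w (subtreeKeys T s) ≤ wsum w (keys T) :=
    wsum_le_wsum hw (subtreeKeys_subset_keys _ _) subset_rfl
  have hlog := Real.logb_le_logb_of_le one_lt_two ht₀ hW₀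
  rw [Real.logb_div (ht₀.trans_le hW₀).ne' ht₀.ne']
  have hnot : ∀ a ∈ X, ∀ b ∈ X, a ≠ b → b ∉ subtreeKeys T' a := fun a ha b hb hab hmem => by
    have : b ∈ subtreeKeys T' a ∩ subtreeKeys T' b := Finset.mem_inter.2 ⟨hmem, hself' b hb⟩
    simp [hdisj a ha b hb hab] at this
  by_cases hsX : s ∈ X
  · have hXs : X = {s} := by
      refine Finset.eq_singleton_iff_unique_mem.2 ⟨hsX, fun a ha => ?_⟩
      by_contra hne
      exact hnot s hsX a ha (Ne.symm hne) (hroot' ▸ (hpath a ha).1)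
    simp only [hXs, Finset.card_singleton, Nat.cast_one, phiOn, Finset.sum_singleton, hroot']
    linarith
  have hside : ∀ (f : ℕ → ℤ) (A : Finset ℕ), A ⊆ X →
      (∀ a ∈ A, ∀ b ∈ A, a ≠ b → f a ≤ f b → (s < a ∧ a < b) ∨ (b < a ∧ a < s)) →
      ∑ a ∈ A, (1 + Real.logb 2 (wsum w (subtreeKeys T' a)) -
        Real.logb 2 (wsum w (subtreeKeys T a))) ≤
      2 * (Real.logb 2 (wsum w (keys T)) - Real.logb 2 (wsum w (subtreeKeys T s))) + 1 := by
    intro f A hA hf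
    refine sum_one_add_logb_sub_logb_le_add_one hw _ _ f ht₀ A
      (fun a ha => ⟨a, hself' a (hA ha)⟩)
      (fun a ha => wsum_le_wsum hw (subtreeKeys_subset_of_mem hT (hpath a (hA ha)).2)
        (subtreeKeys_subset_keys _ _))
      (fun a ha b hb hab => Finset.disjoint_iff_inter_eq_empty.2 (hdisj a (hA ha) b (hA hb) hab))
      ?_ (fun a _ => ⟨subtreeKeys_subset_keys _ _, hkeys ▸ subtreeKeys_subset_keys T' a⟩) hW₀
    intro a ha b hb hab hfab
    obtain ⟨haK, -⟩ := hpath a (hA ha)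
    obtain ⟨hbK, hsb⟩ := hpath b (hA hb)
    have hbb := mem_subtreeKeys_self hT hbK
    have hba' := hnot a (hA ha) b (hA hb) hab
    have haa' := hself' a (hA ha)
    have hsa' : s ∉ subtreeKeys T' a := fun h =>
      hba' (subtreeKeys_subset_of_mem hT' h (hroot' ▸ hbK))
    rcases hf a ha b hb hab hfab with ⟨h₁, h₂⟩ | ⟨h₁, h₂⟩
    · refine ⟨subtreeKeys_subset_of_mem hT
        (mem_subtreeKeys_of_between hT hsb hbb haK h₁.le h₂.le), fun y hy => ?_⟩
      refine mem_subtreeKeys_of_between hT hsb hbb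
        (hkeys ▸ subtreeKeys_subset_keys T' a hy) ?_ ?_
      · by_contra! h
        exact hsa' (mem_subtreeKeys_of_between hT' hy haa' (hkeys.symm ▸ hs) h.le h₁.le)
      · by_contra! h
        exact hba' (mem_subtreeKeys_of_between hT' haa' hy (hkeys.symm ▸ hbK) h₂.le h.le)
    · refine ⟨subtreeKeys_subset_of_mem hT
        (mem_subtreeKeys_of_between hT hbb hsb haK h₁.le h₂.le), fun y hy => ?_⟩
      refine mem_subtreeKeys_of_between hT hbb hsb
        (hkeys ▸ subtreeKeys_subset_keys T' a hy) ?_ ?_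
      · by_contra! h
        exact hba' (mem_subtreeKeys_of_between hT' hy haa' (hkeys.symm ▸ hbK) h.le h₁.le)
      · by_contra! h
        exact hsa' (mem_subtreeKeys_of_between hT' haa' hy (hkeys.symm ▸ hs) h₂.le h.le)
  have hright := hside (fun a => a) (X.filter (s < ·)) (Finset.filter_subset _ _) (by
    intro a ha b hb hab hfab
    have := (Finset.mem_filter.1 ha).2
    omega)
  have hleft := hside (fun a => -a) (X.filter (¬ s < ·)) (Finset.filter_subset _ _) (by
    intro a ha b hb hab hfab
    obtain ⟨haX, has⟩ := Finset.mem_filter.1 ha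
    have : a ≠ s := fun h => hsX (h ▸ haX)
    omega)
  have hsplit := Finset.sum_filter_add_sum_filter_not X (s < ·)
    fun a => 1 + Real.logb 2 (wsum w (subtreeKeys T' a)) - Real.logb 2 (wsum w (subtreeKeys T a))
  have hexp : ∑ a ∈ X, (1 + Real.logb 2 (wsum w (subtreeKeys T' a)) -
      Real.logb 2 (wsum w (subtreeKeys T a))) = X.card + phiOn w T' X - phiOn w T X := by
    simp [phiOn, Finset.sum_sub_distrib, Finset.sum_add_distrib]
  linarith
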